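/- Interior derivative estimate for the heat equation: if u solves Δu − ∂_t u = 0 on an open set Ω ⊂ ℝ^{m+1} containing the closed unit ball centered at the origin, then for each multiindex k there is a constant C_k, depending only on k and the dimension, such that sup_{z ∈ B_{1/4}(0)} |∂^k u(z)| ≤ C_k · sup_{z ∈ B_1(0)} |u(z)|. -/

import Mathlib

open scoped BigOperators
open Metric

/-- Partial derivative of `f` in the `i`-th coordinate direction. -/
noncomputable def pd {n : ℕ} {F : Type*} [NormedAddCommGroup F] [NormedSpace ℝ F]
    (i : Fin n) (f : EuclideanSpace ℝ (Fin n) → F) : EuclideanSpace ℝ (Fin n) → F :=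
  fun z => fderiv ℝ f z (EuclideanSpace.single i 1)

/-- Iterated partial derivative in the `i`-th coordinate direction. -/
noncomputable def pdIter {n : ℕ} {F : Type*} [NormedAddCommGroup F] [NormedSpace ℝ F]
    (i : Fin n) : ℕ → (EuclideanSpace ℝ (Fin n) → F) → EuclideanSpace ℝ (Fin n) → F
  | 0, f => f
  | k + 1, f => pd i (pdIter i k f)

/-- The mixed partial derivative `∂^k f` associated to the multiindex `k`. -/
noncomputable def mderiv {n : ℕ} {F : Type*} [NormedAddCommGroup F] [NormedSpace ℝ F]
    (k : Fin n → ℕ) (f : EuclideanSpace ℝ (Fin n) → F) : EuclideanSpace ℝ (Fin n) → F :=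
  (List.finRange n).foldr (fun i g => pdIter i (k i) g) f

/-- `u` solves the heat equation `Δu - ∂ₜu = 0` on `Ω ⊆ ℝ^{m+1}`, where the first `m`
coordinates are spatial and the last coordinate is time. -/
def IsHeatSolution {m : ℕ} (Ω : Set (EuclideanSpace ℝ (Fin (m + 1))))
    (u : EuclideanSpace ℝ (Fin (m + 1)) → ℝ) : Prop :=
  ∀ z ∈ Ω, (∑ i : Fin m, pd i.castSucc (pd i.castSucc u) z) - pd (Fin.last m) u z = 0

/-- The parabolic rescaling `(x, t) ↦ (rx, r²t)` of `ℝ^{m+1}`. -/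
noncomputable def parabolicScale (m : ℕ) (r : ℝ) :
    EuclideanSpace ℝ (Fin (m + 1)) → EuclideanSpace ℝ (Fin (m + 1)) :=
  fun z => (WithLp.equiv 2 (Fin (m + 1) → ℝ)).symm
    (fun i => if i = Fin.last m then r ^ 2 * z i else r * z i)

open Filter Topology

/-- The necessary second-order condition at a local maximum. -/
theorem IsLocalMax.second_deriv_nonpos {f f' : ℝ → ℝ} {f'' x : ℝ} (hmax : IsLocalMax f x)
    (hf : ∀ᶠ s in 𝓝 x, HasDerivAt f (f' s) s) (hf' : HasDerivAt f' f'' x) : f'' ≤ 0 := by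
  by_contra! hpos
  have hderiv : deriv f =ᶠ[𝓝 x] f' := hf.mono fun s hs => hs.deriv
  have hmin : IsLocalMin f x := by
    refine isLocalMin_of_deriv_deriv_pos ?_ hmax.deriv_eq_zero hf.self_of_nhds.continuousAt
    rwa [hderiv.deriv_eq, hf'.deriv]
  have hconst : f =ᶠ[𝓝 x] fun _ => f x := by
    filter_upwards [hmax, hmin] with s h₁ h₂ using le_antisymm h₁ h₂
  have hzero : deriv f =ᶠ[𝓝 x] fun _ => 0 := by
    simpa using hconst.deriv
  have := (hderiv.symm.trans hzero).deriv_eq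
  rw [hf'.deriv, deriv_const] at this
  exact hpos.ne' this

/-- First and second order conditions along a line for the Bernstein auxiliary function
`a² p² + A v²`. -/
theorem bernstein_line_conditions {a p v a' p' v' : ℝ → ℝ} {a'' p'' v'' A : ℝ}
    (ha : ∀ᶠ s in 𝓝 0, HasDerivAt a (a' s) s) (ha' : HasDerivAt a' a'' 0)
    (hp : ∀ᶠ s in 𝓝 0, HasDerivAt p (p' s) s) (hp' : HasDerivAt p' p'' 0)
    (hv : ∀ᶠ s in 𝓝 0, HasDerivAt v (v' s) s) (hv' : HasDerivAt v' v'' 0)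
    (hmax : IsLocalMax (fun s => a s ^ 2 * p s ^ 2 + A * v s ^ 2) 0) :
    a 0 * a' 0 * p 0 ^ 2 + a 0 ^ 2 * (p 0 * p' 0) + A * (v 0 * v' 0) = 0 ∧
    a' 0 ^ 2 * p 0 ^ 2 + a 0 * a'' * p 0 ^ 2 + 4 * (a 0 * a' 0 * p 0 * p' 0)
      + a 0 ^ 2 * p' 0 ^ 2 + a 0 ^ 2 * (p 0 * p'') + A * (v' 0 ^ 2 + v 0 * v'') ≤ 0 := by
  have hd : ∀ᶠ s in 𝓝 0, HasDerivAt (fun s => a s ^ 2 * p s ^ 2 + A * v s ^ 2)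
      (2 * (a s * a' s * p s ^ 2 + a s ^ 2 * (p s * p' s) + A * (v s * v' s))) s := by
    filter_upwards [ha, hp, hv] with s has hps hvs
    refine (((has.pow 2).mul (hps.pow 2)).add ((hvs.pow 2).const_mul A)).congr_deriv ?_
    simp only [Pi.pow_apply]
    push_cast
    ring
  have ha₀ := ha.self_of_nhds
  have hp₀ := hp.self_of_nhds
  have hv₀ := hv.self_of_nhds
  constructor
  · have := hmax.hasDerivAt_eq_zero hd.self_of_nhds
    linarith
  · have hdd := (((ha₀.mul ha').mul (hp₀.pow 2)).add ((ha₀.pow 2).mul (hp₀.mul hp'))).add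
      ((hv₀.mul hv').const_mul A) |>.const_mul 2
    have := hmax.second_deriv_nonpos hd hdd
    simp only [Pi.pow_apply, Pi.mul_apply] at this
    push_cast at this
    linarith

section PartialDerivatives

variable {n : ℕ} {Ω : Set (EuclideanSpace ℝ (Fin n))} {f : EuclideanSpace ℝ (Fin n) → ℝ}
  {z : EuclideanSpace ℝ (Fin n)}

theorem ContDiffOn.partialDeriv (hf : ContDiffOn ℝ (⊤ : ℕ∞) f Ω) (hΩ : IsOpen Ω) (i : Fin n) :
    ContDiffOn ℝ (⊤ : ℕ∞) (pd i f) Ω :=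
  (hf.fderiv_of_isOpen hΩ (m := (⊤ : ℕ∞)) (by simp)).clm_apply contDiffOn_const

theorem ContDiffOn.differentiableAt_of_isOpen (hf : ContDiffOn ℝ (⊤ : ℕ∞) f Ω) (hΩ : IsOpen Ω)
    (hz : z ∈ Ω) : DifferentiableAt ℝ f z :=
  (hf.contDiffAt (hΩ.mem_nhds hz)).differentiableAt (by simp)

theorem Filter.EventuallyEq.pd_eq {g : EuclideanSpace ℝ (Fin n) → ℝ} (h : f =ᶠ[𝓝 z] g)
    (i : Fin n) : pd i f z = pd i g z := by
  simp only [pd, h.fderiv_eq]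

theorem pd_pd_apply (hf : ContDiffOn ℝ (⊤ : ℕ∞) f Ω) (hΩ : IsOpen Ω) (hz : z ∈ Ω) (i j : Fin n) :
    pd i (pd j f) z =
      fderiv ℝ (fderiv ℝ f) z (EuclideanSpace.single i 1) (EuclideanSpace.single j 1) := by
  have hd : DifferentiableAt ℝ (fderiv ℝ f) z :=
    ((hf.fderiv_of_isOpen hΩ (m := (⊤ : ℕ∞)) (by simp)).contDiffAt
      (hΩ.mem_nhds hz)).differentiableAt (by simp)
  change fderiv ℝ (fun y => fderiv ℝ f y (EuclideanSpace.single j 1)) z _ = _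
  rw [fderiv_clm_apply hd (differentiableAt_const _)]
  simp

theorem pd_comm (hf : ContDiffOn ℝ (⊤ : ℕ∞) f Ω) (hΩ : IsOpen Ω) (hz : z ∈ Ω) (i j : Fin n) :
    pd i (pd j f) z = pd j (pd i f) z := by
  rw [pd_pd_apply hf hΩ hz, pd_pd_apply hf hΩ hz]
  exact (hf.contDiffAt (hΩ.mem_nhds hz)).isSymmSndFDerivAt
    (by simpa using WithTop.coe_le_coe.mpr (le_top : (2 : ℕ∞) ≤ ⊤)) _ _

theorem tendsto_add_smul_single (z : EuclideanSpace ℝ (Fin n)) (i : Fin n) :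
    Tendsto (fun s : ℝ => z + s • EuclideanSpace.single i (1 : ℝ)) (𝓝 0) (𝓝 z) := by
  have h : Continuous fun s : ℝ => z + s • EuclideanSpace.single i (1 : ℝ) := by fun_prop
  simpa using h.tendsto 0

theorem hasDerivAt_along_single (hf : ContDiffOn ℝ (⊤ : ℕ∞) f Ω) (hΩ : IsOpen Ω) (i : Fin n)
    {s : ℝ} (hs : z + s • EuclideanSpace.single i (1 : ℝ) ∈ Ω) :
    HasDerivAt (fun s : ℝ => f (z + s • EuclideanSpace.single i (1 : ℝ)))
      (pd i f (z + s • EuclideanSpace.single i (1 : ℝ))) s := by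
  have hline : HasDerivAt (fun s : ℝ => z + s • EuclideanSpace.single i (1 : ℝ))
      (EuclideanSpace.single i (1 : ℝ)) s := by
    simpa using ((hasDerivAt_id s).smul_const (EuclideanSpace.single i (1 : ℝ))).const_add z
  exact (hf.differentiableAt_of_isOpen hΩ hs).hasFDerivAt.comp_hasDerivAt s hline

theorem norm_sq_add_smul_single (z : EuclideanSpace ℝ (Fin n)) (i : Fin n) (s : ℝ) :
    ‖z + s • EuclideanSpace.single i (1 : ℝ)‖ ^ 2 = ‖z‖ ^ 2 + 2 * s * z i + s ^ 2 := by
  rw [norm_add_sq_real, norm_smul, real_inner_smul_right]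
  simp [EuclideanSpace.inner_single_right]
  ring

/-- Coordinatewise first and second order conditions at a local maximum of
`(r² - |z|²)² p² + A v²`. -/
theorem bernstein_coordinate_conditions {p v : EuclideanSpace ℝ (Fin n) → ℝ} {r A : ℝ}
    (hΩ : IsOpen Ω) (hp : ContDiffOn ℝ (⊤ : ℕ∞) p Ω) (hv : ContDiffOn ℝ (⊤ : ℕ∞) v Ω)
    (hz : z ∈ Ω)
    (hmax : IsLocalMax (fun y => (r ^ 2 - ‖y‖ ^ 2) ^ 2 * p y ^ 2 + A * v y ^ 2) z) (i : Fin n) :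
    (r ^ 2 - ‖z‖ ^ 2) * (-2 * z i) * p z ^ 2 + (r ^ 2 - ‖z‖ ^ 2) ^ 2 * (p z * pd i p z)
      + A * (v z * pd i v z) = 0 ∧
    (-2 * z i) ^ 2 * p z ^ 2 + (r ^ 2 - ‖z‖ ^ 2) * (-2) * p z ^ 2
      + 4 * ((r ^ 2 - ‖z‖ ^ 2) * (-2 * z i) * p z * pd i p z)
      + (r ^ 2 - ‖z‖ ^ 2) ^ 2 * pd i p z ^ 2 + (r ^ 2 - ‖z‖ ^ 2) ^ 2 * (p z * pd i (pd i p) z)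
      + A * (pd i v z ^ 2 + v z * pd i (pd i v) z) ≤ 0 := by
  have hΩ' : ∀ᶠ s : ℝ in 𝓝 0, z + s • EuclideanSpace.single i (1 : ℝ) ∈ Ω :=
    tendsto_add_smul_single z i (hΩ.mem_nhds hz)
  have hline : IsLocalMax (fun s : ℝ => (r ^ 2 - ‖z + s • EuclideanSpace.single i (1 : ℝ)‖ ^ 2) ^ 2
      * p (z + s • EuclideanSpace.single i (1 : ℝ)) ^ 2
      + A * v (z + s • EuclideanSpace.single i (1 : ℝ)) ^ 2) 0 := by
    have := (tendsto_add_smul_single z i).eventually hmax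
    simpa only [IsLocalMax, IsMaxFilter, zero_smul, add_zero] using this
  have hcut : ∀ s : ℝ, HasDerivAt
      (fun s : ℝ => r ^ 2 - ‖z + s • EuclideanSpace.single i (1 : ℝ)‖ ^ 2)
      (-2 * z i - 2 * s) s := by
    intro s
    simp only [norm_sq_add_smul_single]
    have h := ((((hasDerivAt_id s).const_mul 2).mul_const (z i)).const_add (‖z‖ ^ 2)).add
      ((hasDerivAt_id s).pow 2) |>.const_sub (r ^ 2)
    refine h.congr_deriv ?_
    push_cast
    simp only [id]
    ring
  have hcut' : HasDerivAt (fun s : ℝ => -2 * z i - 2 * s) (-2) 0 := by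
    simpa using ((hasDerivAt_id (0 : ℝ)).const_mul 2).const_sub (-2 * z i)
  have hz0 : z + (0 : ℝ) • EuclideanSpace.single i (1 : ℝ) ∈ Ω := by simpa using hz
  have h := bernstein_line_conditions (Eventually.of_forall hcut) hcut'
    (hΩ'.mono fun s hs => hasDerivAt_along_single hp hΩ i hs)
    (hasDerivAt_along_single (hp.partialDeriv hΩ i) hΩ i hz0)
    (hΩ'.mono fun s hs => hasDerivAt_along_single hv hΩ i hs)
    (hasDerivAt_along_single (hv.partialDeriv hΩ i) hΩ i hz0) hline
  simpa using h

end PartialDerivatives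

section HeatEquation

variable {m : ℕ} {Ω : Set (EuclideanSpace ℝ (Fin (m + 1)))}
  {u : EuclideanSpace ℝ (Fin (m + 1)) → ℝ}

/-- Partial derivatives of a smooth solution of the heat equation are solutions. -/
theorem IsHeatSolution.partialDeriv (hu : IsHeatSolution Ω u) (hΩ : IsOpen Ω)
    (hs : ContDiffOn ℝ (⊤ : ℕ∞) u Ω) (i : Fin (m + 1)) : IsHeatSolution Ω (pd i u) := by
  intro z hz
  have hz' := hΩ.mem_nhds hz
  have hcomm : ∀ j k, pd j (pd k (pd i u)) z
      = pd i (pd j (pd k u)) z := by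
    intro j k
    have : pd k (pd i u) =ᶠ[𝓝 z] pd i (pd k u) :=
      eventually_of_mem hz' fun y hy => pd_comm hs hΩ hy k i
    rw [this.pd_eq, pd_comm (hs.partialDeriv hΩ k) hΩ hz]
  have hzero : (fun y => (∑ j : Fin m, pd j.castSucc (pd j.castSucc u) y)
      - pd (Fin.last m) u y) =ᶠ[𝓝 z] fun _ => 0 := eventually_of_mem hz' hu
  have hpd := hzero.pd_eq i
  have hdiff : ∀ j ∈ Finset.univ, DifferentiableAt ℝ
      (fun y => pd (Fin.castSucc j) (pd (Fin.castSucc j) u) y) z := fun j _ =>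
    ((hs.partialDeriv hΩ j.castSucc).partialDeriv hΩ j.castSucc).differentiableAt_of_isOpen hΩ hz
  have hexpand : pd i (fun y => (∑ j : Fin m, pd j.castSucc (pd j.castSucc u) y)
      - pd (Fin.last m) u y) z
      = (∑ j : Fin m, pd i (pd j.castSucc (pd j.castSucc u)) z) - pd i (pd (Fin.last m) u) z := by
    change fderiv ℝ _ z _ = _
    rw [fderiv_fun_sub (DifferentiableAt.fun_sum hdiff)
      ((hs.partialDeriv hΩ (Fin.last m)).differentiableAt_of_isOpen hΩ hz), fderiv_fun_sum hdiff,
      sub_apply, sum_apply]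
    rfl
  simp only [hcomm]
  rw [pd_comm hs hΩ hz, ← hexpand, hpd]
  simp [pd]

/-- At an interior maximum of the Bernstein auxiliary function the differentiated quantity
vanishes. -/
theorem IsHeatSolution.pd_eq_zero_of_isLocalMax (hu : IsHeatSolution Ω u) (hΩ : IsOpen Ω)
    (hs : ContDiffOn ℝ (⊤ : ℕ∞) u Ω) (i : Fin m) {r : ℝ} (hr : 0 ≤ r) (hr1 : r ≤ 1)
    {z : EuclideanSpace ℝ (Fin (m + 1))} (hz : z ∈ Ω) (hzr : ‖z‖ ≤ r)
    (hmax : IsLocalMax (fun y => (r ^ 2 - ‖y‖ ^ 2) ^ 2 * pd i.castSucc u y ^ 2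
      + (20 + 2 * m) * u y ^ 2) z) : pd i.castSucc u z = 0 := by
  have hps := hs.partialDeriv hΩ i.castSucc
  have hcond := bernstein_coordinate_conditions hΩ hps hs hz hmax
  have hheat := hu z hz
  have hheat' := hu.partialDeriv hΩ hs i.castSucc z hz
  set p := pd i.castSucc u with hp
  set a := r ^ 2 - ‖z‖ ^ 2 with ha
  set A : ℝ := 20 + 2 * m with hA
  have hnorm : ‖z‖ ^ 2 = (∑ j : Fin m, z j.castSucc ^ 2) + z (Fin.last m) ^ 2 := by
    rw [EuclideanSpace.real_norm_sq_eq, Fin.sum_univ_castSucc]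
  have hz1 : ‖z‖ ^ 2 ≤ 1 := by nlinarith [norm_nonneg z]
  have ha0 : 0 ≤ a := by nlinarith [norm_nonneg z]
  have ha1 : a ≤ 1 := by nlinarith [norm_nonneg z]
  have hA0 : 0 ≤ A := by positivity
  obtain ⟨ht, -⟩ := hcond (Fin.last m)
  have hsum : ∑ j : Fin m, (-12 * z j.castSucc ^ 2 * p z ^ 2 - 2 * a * p z ^ 2
      + a ^ 2 * (p z * pd j.castSucc (pd j.castSucc p) z)
      + A * (pd j.castSucc u z ^ 2
        + u z * pd j.castSucc (pd j.castSucc u) z)) ≤ 0 := by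
    refine Finset.sum_nonpos fun j _ => ?_
    obtain ⟨-, h⟩ := hcond j.castSucc
    nlinarith [sq_nonneg (a * pd j.castSucc p z - 4 * z j.castSucc * p z)]
  have hgrad : p z ^ 2 ≤ ∑ j : Fin m, pd j.castSucc u z ^ 2 :=
    Finset.single_le_sum (f := fun j : Fin m => pd j.castSucc u z ^ 2)
      (fun j _ => sq_nonneg _) (Finset.mem_univ i)
  simp only [Finset.sum_add_distrib, Finset.sum_sub_distrib, ← Finset.mul_sum, ← Finset.sum_mul,
    Finset.sum_const, Finset.card_univ, Fintype.card_fin, nsmul_eq_mul] at hsum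
  set S := ∑ j : Fin m, z j.castSucc ^ 2
  set G := ∑ j : Fin m, pd j.castSucc u z ^ 2
  rw [sub_eq_zero.mp hheat, sub_eq_zero.mp hheat'] at hsum
  have hp2 := sq_nonneg (p z)
  have hS : S ≤ 1 := by nlinarith [sq_nonneg (z (Fin.last m))]
  have hS0 : 0 ≤ S := Finset.sum_nonneg fun j _ => sq_nonneg _
  have ht1 : -1 ≤ z (Fin.last m) := by nlinarith
  have hat : -1 ≤ a * z (Fin.last m) := by nlinarith
  have hm : (0 : ℝ) ≤ m := m.cast_nonneg
  have hma : m * a ≤ m := mul_le_of_le_one_right hm ha1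
  have hAG : A * p z ^ 2 ≤ A * G := mul_le_mul_of_nonneg_left hgrad hA0
  have hfinal : (A - 12 * S - 2 * (m * a) + 2 * (a * z (Fin.last m))) * p z ^ 2 ≤ 0 := by
    linarith
  have hcoef : 1 ≤ A - 12 * S - 2 * (m * a) + 2 * (a * z (Fin.last m)) := by linarith
  have : p z ^ 2 ≤ 0 := by nlinarith
  exact pow_eq_zero_iff two_ne_zero |>.mp (le_antisymm this hp2)

/-- Bernstein's estimate for the spatial derivatives of a solution of the heat equation. -/
theorem IsHeatSolution.cutoff_mul_pd_sq_le (hu : IsHeatSolution Ω u) (hΩ : IsOpen Ω)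
    (hs : ContDiffOn ℝ (⊤ : ℕ∞) u Ω) (i : Fin m) {r : ℝ} (hr : 0 < r) (hr1 : r ≤ 1)
    (hball : closedBall 0 r ⊆ Ω) {M : ℝ} (hM : ∀ z ∈ closedBall 0 r, |u z| ≤ M)
    {z : EuclideanSpace ℝ (Fin (m + 1))} (hz : z ∈ closedBall 0 r) :
    (r ^ 2 - ‖z‖ ^ 2) ^ 2 * pd i.castSucc u z ^ 2 ≤ (20 + 2 * m) * M ^ 2 := by
  have hcont : ContinuousOn (fun y : EuclideanSpace ℝ (Fin (m + 1)) =>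
      (r ^ 2 - ‖y‖ ^ 2) ^ 2 * pd i.castSucc u y ^ 2 + (20 + 2 * m) * u y ^ 2)
      (closedBall 0 r) := by
    have h₁ := (hs.partialDeriv hΩ i.castSucc).continuousOn.mono hball
    have h₂ := hs.continuousOn.mono hball
    fun_prop
  obtain ⟨y, hy, hymax⟩ := (isCompact_closedBall _ r).exists_isMaxOn ⟨z, hz⟩ hcont
  have hyr : ‖y‖ ≤ r := by simpa using hy
  have hterm : (r ^ 2 - ‖y‖ ^ 2) ^ 2 * pd i.castSucc u y ^ 2 = 0 := by
    rcases hyr.lt_or_eq with hlt | heq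
    · have hloc : IsLocalMax _ y :=
        hymax.isLocalMax (mem_of_superset (isOpen_ball.mem_nhds (by simpa using hlt))
          ball_subset_closedBall)
      rw [hu.pd_eq_zero_of_isLocalMax hΩ hs i hr.le hr1 (hball hy) hyr hloc]
      ring
    · rw [heq]
      ring
  have hle := hymax hz
  simp only [Set.mem_ofPred_eq, hterm] at hle
  have huM : u y ^ 2 ≤ M ^ 2 := sq_le_sq' (abs_le.mp (hM y hy)).1 (abs_le.mp (hM y hy)).2
  have : (20 + 2 * m : ℝ) * u y ^ 2 ≤ (20 + 2 * m) * M ^ 2 := by gcongr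
  have : (0 : ℝ) ≤ (20 + 2 * m) * u z ^ 2 := by positivity
  linarith

/-- An operator preserving smooth solutions of the heat equation and bounded, with constants
independent of the solution, from the sup norm on a ball to the sup norm on smaller ones. -/
def HeatInteriorBounded (m : ℕ)
    (T : (EuclideanSpace ℝ (Fin (m + 1)) → ℝ) → EuclideanSpace ℝ (Fin (m + 1)) → ℝ) : Prop :=
  (∀ (Ω : Set (EuclideanSpace ℝ (Fin (m + 1)))) (u : EuclideanSpace ℝ (Fin (m + 1)) → ℝ),
    IsOpen Ω → ContDiffOn ℝ (⊤ : ℕ∞) u Ω → IsHeatSolution Ω u →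
      ContDiffOn ℝ (⊤ : ℕ∞) (T u) Ω ∧ IsHeatSolution Ω (T u)) ∧
  ∀ r' r : ℝ, 0 < r' → r' < r → r ≤ 1 → ∃ C : ℝ, 0 < C ∧
    ∀ (Ω : Set (EuclideanSpace ℝ (Fin (m + 1)))) (u : EuclideanSpace ℝ (Fin (m + 1)) → ℝ),
      IsOpen Ω → ContDiffOn ℝ (⊤ : ℕ∞) u Ω → IsHeatSolution Ω u → closedBall 0 r ⊆ Ω →
      ∀ M : ℝ, (∀ z ∈ closedBall 0 r, |u z| ≤ M) → ∀ z ∈ closedBall 0 r', |T u z| ≤ C * M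

namespace HeatInteriorBounded

variable {S T : (EuclideanSpace ℝ (Fin (m + 1)) → ℝ) → EuclideanSpace ℝ (Fin (m + 1)) → ℝ}

theorem refl : HeatInteriorBounded m fun u => u := by
  refine ⟨fun _ _ _ hs hu => ⟨hs, hu⟩, fun r' r _ hlt _ => ⟨1, one_pos, ?_⟩⟩
  intro Ω u _ _ _ _ M hM z hz
  simpa using hM z (closedBall_subset_closedBall hlt.le hz)

theorem comp (hS : HeatInteriorBounded m S) (hT : HeatInteriorBounded m T) :
    HeatInteriorBounded m fun u => S (T u) := by
  refine ⟨fun Ω u hΩ hs hu => ?_, fun r' r hr' hlt hr => ?_⟩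
  · obtain ⟨h₁, h₂⟩ := hT.1 Ω u hΩ hs hu
    exact hS.1 Ω _ hΩ h₁ h₂
  · obtain ⟨ρ, hρ', hρ⟩ := exists_between hlt
    obtain ⟨C, hC, hCS⟩ := hS.2 r' ρ hr' hρ' (hρ.le.trans hr)
    obtain ⟨D, hD, hDT⟩ := hT.2 ρ r (hr'.trans hρ') hρ hr
    refine ⟨C * D, mul_pos hC hD, fun Ω u hΩ hs hu hball M hM z hz => ?_⟩
    obtain ⟨h₁, h₂⟩ := hT.1 Ω u hΩ hs hu
    rw [mul_assoc]
    exact hCS Ω _ hΩ h₁ h₂ ((closedBall_subset_closedBall hρ.le).trans hball) _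
      (hDT Ω u hΩ hs hu hball M hM) z hz

theorem pd_castSucc (i : Fin m) : HeatInteriorBounded m (pd i.castSucc) := by
  refine ⟨fun Ω u hΩ hs hu => ⟨hs.partialDeriv hΩ _, hu.partialDeriv hΩ hs _⟩, fun r' r hr' hlt hr => ?_⟩
  have hgap : 0 < r ^ 2 - r' ^ 2 := by nlinarith
  refine ⟨√(20 + 2 * m) / (r ^ 2 - r' ^ 2), by positivity, ?_⟩
  intro Ω u hΩ hs hu hball M hM z hz
  have hr0 := hr'.trans hlt
  have hM0 : 0 ≤ M := (abs_nonneg _).trans (hM 0 (mem_closedBall_self hr0.le))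
  have hzr : ‖z‖ ≤ r' := by simpa using hz
  have h := hu.cutoff_mul_pd_sq_le hΩ hs i hr0 hr hball hM (closedBall_subset_closedBall hlt.le hz)
  rw [div_mul_eq_mul_div, le_div_iff₀ hgap]
  refine abs_le_of_sq_le_sq' ?_ (by positivity) |>.2
  have hcut : (r ^ 2 - r' ^ 2) ^ 2 ≤ (r ^ 2 - ‖z‖ ^ 2) ^ 2 := by gcongr
  rw [mul_pow, mul_pow, sq_abs, Real.sq_sqrt (by positivity), mul_comm]
  exact (mul_le_mul_of_nonneg_right hcut (sq_nonneg _)).trans h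

theorem pd_last : HeatInteriorBounded m (pd (Fin.last m)) := by
  refine ⟨fun Ω u hΩ hs hu => ⟨hs.partialDeriv hΩ _, hu.partialDeriv hΩ hs _⟩, fun r' r hr' hlt hr => ?_⟩
  choose C hC hbound using fun j : Fin m =>
    ((pd_castSucc j).comp (pd_castSucc j)).2 r' r hr' hlt hr
  have hsum : 0 ≤ ∑ j, C j := Finset.sum_nonneg fun j _ => (hC j).le
  refine ⟨∑ j, C j + 1, by positivity, fun Ω u hΩ hs hu hball M hM z hz => ?_⟩
  have hM0 : 0 ≤ M := (abs_nonneg _).trans (hM 0 (mem_closedBall_self (hr'.trans hlt).le))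
  have hzΩ : z ∈ Ω := hball (closedBall_subset_closedBall hlt.le hz)
  rw [← sub_eq_zero.mp (hu z hzΩ)]
  calc |∑ j : Fin m, pd j.castSucc (pd j.castSucc u) z|
      ≤ ∑ j : Fin m, |pd j.castSucc (pd j.castSucc u) z| := Finset.abs_sum_le_sum_abs _ _
    _ ≤ ∑ j : Fin m, C j * M :=
        Finset.sum_le_sum fun j _ => hbound j Ω u hΩ hs hu hball M hM z hz
    _ ≤ (∑ j, C j + 1) * M := by
        rw [← Finset.sum_mul]
        nlinarith

theorem partialDeriv (i : Fin (m + 1)) : HeatInteriorBounded m (pd i) :=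
  Fin.lastCases pd_last pd_castSucc i

theorem iterPartialDeriv (i : Fin (m + 1)) (k : ℕ) : HeatInteriorBounded m (pdIter i k) := by
  induction k with
  | zero => exact refl
  | succ k ih => exact (partialDeriv i).comp ih

theorem multiDeriv (k : Fin (m + 1) → ℕ) : HeatInteriorBounded m (mderiv k) := by
  unfold mderiv
  induction List.finRange (m + 1) with
  | nil => exact refl
  | cons i l ih => exact (iterPartialDeriv i (k i)).comp ih

end HeatInteriorBounded

end HeatEquation

/-- Interior derivative estimate for the heat equation: for each multiindex `k` there is a
constant `C_k` (depending only on `k` and the dimension) such that any solution `u` of the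
heat equation on an open set containing the closed unit ball satisfies
`sup_{B_{1/4}(0)} |∂^k u| ≤ C_k · sup_{B_1(0)} |u|`. -/
theorem heat_interior_derivative_estimate (m : ℕ) (k : Fin (m + 1) → ℕ) :
    ∃ C : ℝ, 0 < C ∧
      ∀ (Ω : Set (EuclideanSpace ℝ (Fin (m + 1)))) (u : EuclideanSpace ℝ (Fin (m + 1)) → ℝ),
        IsOpen Ω → closedBall (0 : EuclideanSpace ℝ (Fin (m + 1))) 1 ⊆ Ω →
        ContDiffOn ℝ (⊤ : ℕ∞) u Ω → IsHeatSolution Ω u →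
        ∀ M : ℝ, (∀ z ∈ ball (0 : EuclideanSpace ℝ (Fin (m + 1))) 1, |u z| ≤ M) →
        ∀ z ∈ ball (0 : EuclideanSpace ℝ (Fin (m + 1))) (1 / 4),
          |mderiv k u z| ≤ C * M := by
  obtain ⟨C, hC, hbound⟩ :=
    (HeatInteriorBounded.multiDeriv k).2 (1 / 4) (1 / 2) (by norm_num) (by norm_num) (by norm_num)
  refine ⟨C, hC, fun Ω u hΩ hball hs hu M hM z hz => ?_⟩
  exact hbound Ω u hΩ hs hu ((closedBall_subset_closedBall (by norm_num)).trans hball) M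
    (fun y hy => hM y (closedBall_subset_ball (by norm_num) hy)) z (ball_subset_closedBall hz)
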